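/- Let n ≥ 2 and let I be a subset of ℤ/nℤ with |I| ≤ n−2. Then there exists a unique partition ℤ/nℤ = B_1 ⊔ B_2 ⊔ ⋯ ⊔ B_r into blocks such that I = B_1° ∪ B_2° ∪ ⋯ ∪ B_r°. -/

import Mathlib

/-!
STATEMENT 19: Let `n ≥ 2` and let `I ⊆ ℤ/nℤ` with `|I| ≤ n−2`.  Then there exists a
unique partition `ℤ/nℤ = B_1 ⊔ ⋯ ⊔ B_r` into blocks such that
`I = B_1° ∪ ⋯ ∪ B_r°`, where a block is a nonempty proper cyclically-consecutive
subset, its tail is its unique element whose cyclic predecessor is not in the block,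
and its core is the block minus its tail.  (We model `ℤ/nℤ` by `Fin n` with the cyclic
successor `x ↦ x+1 (mod n)`.)
-/

namespace Stmt19

/-- The cyclic predecessor `x - 1 (mod n)` on `Fin n`. -/
def cpred {n : ℕ} (x : Fin n) : Fin n :=
  ⟨((x : ℕ) + n - 1) % n, Nat.mod_lt _ x.pos⟩

/-- `B` is a block: a set of cyclically consecutive elements
`{b, b+1, …, b+k−1} (mod n)` with `1 ≤ k ≤ n−1` (nonempty and proper). -/
def IsBlock (n : ℕ) (B : Finset (Fin n)) : Prop :=
  ∃ b : Fin n, ∃ k : ℕ, 1 ≤ k ∧ k ≤ n - 1 ∧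
    B = (Finset.range k).image (fun t => (⟨((b : ℕ) + t) % n, Nat.mod_lt _ b.pos⟩ : Fin n))

/-- The core `B° = B ∖ {tail of B}`: for a block this is exactly the set of elements of
`B` whose cyclic predecessor also lies in `B`. -/
def core (n : ℕ) (B : Finset (Fin n)) : Finset (Fin n) :=
  B.filter fun x => cpred x ∈ B

/-- The element `b + t (mod n)` of `Fin n`. -/
def shift {n : ℕ} (b : Fin n) (t : ℕ) : Fin n :=
  ⟨((b : ℕ) + t) % n, Nat.mod_lt _ b.pos⟩

lemma mem_core {n : ℕ} {B : Finset (Fin n)} {x : Fin n} :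
    x ∈ core n B ↔ x ∈ B ∧ cpred x ∈ B := by
  simp [core]

lemma isBlock_iff {n : ℕ} {B : Finset (Fin n)} :
    IsBlock n B ↔ ∃ b : Fin n, ∃ k : ℕ, 1 ≤ k ∧ k ≤ n - 1 ∧
      ∀ x, x ∈ B ↔ ∃ t < k, shift b t = x := by
  simp only [IsBlock, Finset.ext_iff, Finset.mem_image, Finset.mem_range, shift]

lemma shift_zero {n : ℕ} (b : Fin n) : shift b 0 = b :=
  Fin.ext (by simp [shift, Nat.mod_eq_of_lt b.isLt])

lemma cpred_shift_succ {n : ℕ} (b : Fin n) (t : ℕ) : cpred (shift b (t + 1)) = shift b t := by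
  have hb := b.pos
  apply Fin.ext
  simp only [cpred, shift]
  rw [Nat.add_sub_assoc hb, Nat.mod_add_mod,
    show (b : ℕ) + (t + 1) + (n - 1) = b + t + n by omega, Nat.add_mod_right]

lemma shift_cpred_succ {n : ℕ} (b : Fin n) (t : ℕ) : shift (cpred b) (t + 1) = shift b t := by
  have hb := b.pos
  apply Fin.ext
  simp only [cpred, shift]
  rw [Nat.mod_add_mod, show (b : ℕ) + n - 1 + (t + 1) = b + t + n by omega, Nat.add_mod_right]

lemma cpred_eq_shift {n : ℕ} (b : Fin n) : cpred b = shift b (n - 1) := by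
  apply Fin.ext
  simp only [cpred, shift]
  rw [Nat.add_sub_assoc b.pos]

lemma cpred_iterate_shift {n : ℕ} (b : Fin n) (s t : ℕ) :
    cpred^[s] (shift b (t + s)) = shift b t := by
  induction s with
  | zero => rfl
  | succ s ih => rw [Function.iterate_succ_apply, ← add_assoc, cpred_shift_succ, ih]

lemma shift_cpred_iterate {n : ℕ} (x : Fin n) (t : ℕ) : shift (cpred^[t] x) t = x := by
  induction t with
  | zero => exact shift_zero x
  | succ t ih => rw [Function.iterate_succ_apply', shift_cpred_succ, ih]

lemma exists_shift_eq {n : ℕ} (b x : Fin n) : ∃ t < n, shift b t = x := by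
  have hb := b.isLt
  have hx := x.isLt
  refine ⟨((x : ℕ) + (n - b)) % n, Nat.mod_lt _ b.pos, Fin.ext ?_⟩
  simp only [shift]
  rw [Nat.add_mod_mod, show (b : ℕ) + (x + (n - b)) = x + n by omega, Nat.add_mod_right,
    Nat.mod_eq_of_lt hx]

lemma shift_injOn {n : ℕ} (b : Fin n) {s t : ℕ} (hs : s < n) (ht : t < n)
    (h : shift b s = shift b t) : s = t := by
  have h' : (b : ℕ) + s ≡ b + t [MOD n] := congrArg Fin.val h
  exact Nat.ModEq.eq_of_lt_of_lt (Nat.ModEq.add_left_cancel' _ h') hs ht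

/-- A block has a tail, and every element is reached from the tail by successors. -/
lemma IsBlock.exists_tail {n : ℕ} {B : Finset (Fin n)} (hB : IsBlock n B) :
    ∃ b ∈ B, cpred b ∉ B ∧ ∀ p : Fin n → Prop, p b →
      (∀ x ∈ B, cpred x ∈ B → p (cpred x) → p x) → ∀ x ∈ B, p x := by
  obtain ⟨b, k, hk, hkn, h⟩ := isBlock_iff.1 hB
  refine ⟨b, (h b).2 ⟨0, hk, shift_zero b⟩, ?_, ?_⟩
  · rw [h, cpred_eq_shift]
    rintro ⟨t, ht, e⟩
    have := shift_injOn b (by omega) (by omega) e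
    omega
  · intro p hb hp x hx
    obtain ⟨t, ht, rfl⟩ := (h x).1 hx
    clear hx
    induction t with
    | zero => rwa [shift_zero]
    | succ t ih =>
      have ht' : t < k := by omega
      apply hp _ ((h _).2 ⟨_, ht, rfl⟩) <;> rw [cpred_shift_succ]
      · exact (h _).2 ⟨_, ht', rfl⟩
      · exact ih ht'

/-- If `I` misses at least two elements, sending each element to the first one outside `I`
among its iterated predecessors defines a map whose fibres are blocks. -/
lemma exists_root {n : ℕ} (hn : 2 ≤ n) (I : Finset (Fin n)) (hI : I.card ≤ n - 2) :
    ∃ T : Fin n → Fin n, (∀ x ∉ I, T x = x) ∧ (∀ x ∈ I, T x = T (cpred x)) ∧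
      (∀ x, T x ∉ I) ∧ ∀ b ∉ I, IsBlock n (Finset.univ.filter fun y => T y = b) := by
  have hcard : 1 < (Iᶜ).card := by
    rw [Finset.card_compl, Fintype.card_fin]
    omega
  obtain ⟨c, hc, -⟩ := Finset.one_lt_card.1 hcard
  have hex (x : Fin n) : ∃ t, cpred^[t] x ∉ I := by
    obtain ⟨t, -, rfl⟩ := exists_shift_eq c x
    refine ⟨t, ?_⟩
    have := cpred_iterate_shift c t 0
    rw [zero_add, shift_zero] at this
    rw [this]
    simpa using hc
  have hout : ∀ x ∉ I, cpred^[Nat.find (hex x)] x = x := by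
    intro x hx
    rw [(Nat.find_eq_zero (hex x)).2 hx]
    rfl
  have hin : ∀ x ∈ I, cpred^[Nat.find (hex x)] x =
      cpred^[Nat.find (hex (cpred x))] (cpred x) := by
    intro x hx
    have hfind : Nat.find (hex x) = Nat.find (hex (cpred x)) + 1 :=
      Nat.find_comp_succ (hex x) (hex (cpred x)) (by simpa using hx)
    rw [hfind, Function.iterate_succ_apply]
  refine ⟨fun x => cpred^[Nat.find (hex x)] x, hout, hin, fun x => Nat.find_spec (hex x), ?_⟩
  intro b hb
  obtain ⟨c, hc, hcb⟩ := Finset.exists_mem_ne hcard b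
  obtain ⟨s, hs, rfl⟩ := exists_shift_eq b c
  have hs0 : s ≠ 0 := by
    rintro rfl
    exact hcb (shift_zero b)
  have hk : ∃ k, 1 ≤ k ∧ shift b k ∉ I := ⟨s, by omega, by simpa using hc⟩
  have hks : Nat.find hk ≤ s := Nat.find_min' hk ⟨by omega, by simpa using hc⟩
  refine isBlock_iff.2 ⟨b, Nat.find hk, (Nat.find_spec hk).1, by omega, fun x => ?_⟩
  simp only [Finset.mem_filter, Finset.mem_univ, true_and]
  constructor
  · intro hx
    refine ⟨Nat.find (hex x), ?_, by rw [← hx, shift_cpred_iterate]⟩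
    by_contra! hle
    have hspec := Nat.find_spec hk
    have hpos := hspec.1
    obtain ⟨r, hr⟩ := Nat.exists_eq_add_of_le hle
    have hxr : x = shift b (Nat.find hk + r) := by
      rw [← hr, ← hx, shift_cpred_iterate]
    refine Nat.find_min (hex x) (m := r) (by omega) ?_
    have := cpred_iterate_shift b r (Nat.find hk)
    rw [← hxr] at this
    rw [this]
    exact hspec.2
  · rintro ⟨t, ht, rfl⟩
    induction t with
    | zero =>
      rw [shift_zero]
      exact hout b hb
    | succ t ih =>
      have hmem : shift b (t + 1) ∈ I := by
        by_contra h
        exact Nat.find_min hk ht ⟨by omega, h⟩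
      rw [hin _ hmem, cpred_shift_succ]
      exact ih (by omega)

theorem stmt_19 (n : ℕ) (hn : 2 ≤ n) (I : Finset (Fin n)) (hI : I.card ≤ n - 2) :
    ∃! P : Finset (Finset (Fin n)),
      (∀ B ∈ P, IsBlock n B) ∧
      (∀ B ∈ P, ∀ B' ∈ P, B ≠ B' → Disjoint B B') ∧
      P.biUnion id = Finset.univ ∧
      P.biUnion (core n) = I := by
  obtain ⟨T, hout, hin, hT, hblock⟩ := exists_root hn I hI
  let F : Fin n → Finset (Fin n) := fun x => Finset.univ.filter fun y => T y = T x
  have hF (x y : Fin n) : y ∈ F x ↔ T y = T x := by simp [F]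
  have hFblock (x : Fin n) : IsBlock n (F x) := hblock _ (hT x)
  refine ⟨Finset.univ.image F, ⟨?_, ?_, ?_, ?_⟩, ?_⟩
  · simpa using hFblock
  · simp only [Finset.mem_image, Finset.mem_univ, true_and]
    rintro _ ⟨x, rfl⟩ _ ⟨x', rfl⟩ hne
    refine Finset.disjoint_left.2 fun y hy hy' => hne ?_
    have h : T x = T x' := ((hF _ _).1 hy).symm.trans ((hF _ _).1 hy')
    simp only [F, h]
  · ext x
    simp only [Finset.mem_biUnion, Finset.mem_image, Finset.mem_univ, true_and, id, iff_true]
    exact ⟨F x, ⟨x, rfl⟩, (hF x x).2 rfl⟩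
  · ext x
    simp only [Finset.mem_biUnion, Finset.mem_image, Finset.mem_univ, true_and, mem_core]
    constructor
    · rintro ⟨_, ⟨z, rfl⟩, hx, hx'⟩
      by_contra hxI
      obtain ⟨b, hb, hb', -⟩ := (hFblock z).exists_tail
      have hbI : b ∉ I := fun h => hb' ((hF _ _).2 ((hin b h).symm.trans ((hF _ _).1 hb)))
      have hbx : b = x := by
        rw [← hout b hbI, ← hout x hxI, (hF _ _).1 hb, (hF _ _).1 hx]
      exact hb' (hbx ▸ hx')
    · intro hx
      exact ⟨F x, ⟨x, rfl⟩, (hF x x).2 rfl, (hF _ _).2 (hin x hx).symm⟩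
  · rintro P ⟨hPblock, hPdisj, hPcover, hPcore⟩
    have huniq {B B' : Finset (Fin n)} {x : Fin n} (hB : B ∈ P) (hB' : B' ∈ P) (hx : x ∈ B)
        (hx' : x ∈ B') : B = B' := by
      by_contra hne
      exact Finset.disjoint_left.1 (hPdisj B hB B' hB' hne) hx hx'
    have hcover (x : Fin n) : ∃ B ∈ P, x ∈ B := by
      have hx : x ∈ P.biUnion id := hPcover ▸ Finset.mem_univ x
      simpa using hx
    have htail : ∀ B ∈ P, ∃ b ∈ B, ∀ x ∈ B, T x = b := by
      intro B hB
      obtain ⟨b, hb, hb', hind⟩ := (hPblock B hB).exists_tail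
      refine ⟨b, hb, hind _ (hout b fun hbI => ?_) fun x hx hx' ih => ?_⟩
      · rw [← hPcore, Finset.mem_biUnion] at hbI
        obtain ⟨B', hB', hbB'⟩ := hbI
        rw [mem_core] at hbB'
        exact hb' (huniq hB' hB hbB'.1 hb ▸ hbB'.2)
      · rw [hin x, ih]
        rw [← hPcore]
        exact Finset.mem_biUnion.2 ⟨B, hB, mem_core.2 ⟨hx, hx'⟩⟩
    have hfib : ∀ B ∈ P, ∀ x ∈ B, F x = B := by
      intro B hB x hx
      obtain ⟨b, hb, hBb⟩ := htail B hB
      ext y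
      rw [hF, hBb x hx]
      refine ⟨fun hy => ?_, hBb y⟩
      obtain ⟨B', hB', hyB'⟩ := hcover y
      obtain ⟨b', hb', hBb'⟩ := htail B' hB'
      have hbb : b' = b := (hBb' y hyB').symm.trans hy
      exact huniq hB' hB (hbb ▸ hb') hb ▸ hyB'
    ext B
    simp only [Finset.mem_image, Finset.mem_univ, true_and]
    constructor
    · intro hB
      obtain ⟨b, hb, -⟩ := htail B hB
      exact ⟨b, hfib B hB b hb⟩
    · rintro ⟨x, rfl⟩
      obtain ⟨B, hB, hx⟩ := hcover x
      rwa [hfib B hB x hx]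

end Stmt19
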